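/- Let α > 0, let Δ : ℝ → ℝ be continuous, let Ψ* be a fixed real (n+m+q)×n matrix, set ℰ(t) = Δ(t)·Ψ*, and suppose the estimator Ψ : ℝ → Matrix(n+m+q, n, ℝ) satisfies Ψ'(t) = α·Δ(t)·(ℰ(t) − Δ(t)·Ψ(t)) for all t ≥ 0. Then: (i) if ∫₀ᵗ Δ(τ)² dτ → ∞ as t → ∞, then Ψ(t) → Ψ* as t → ∞; and (ii) if Δ satisfies the modified interval-excitation condition ∫₀^{t_c} Δ(τ)² dτ ≥ −(1/α)·ln(1 − σ) for some t_c > 0 and σ ∈ (0,1), then with s₀(t) = exp(−α·∫₀ᵗ Δ(τ)² dτ) the finite-time estimate Ψ_F(t) := (1/(1 − s₀(t)))·(Ψ(t) − s₀(t)·Ψ(0)) equals Ψ* for every t ≥ t_c. -/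

import Mathlib

attribute [local instance] Matrix.frobeniusNormedAddCommGroup Matrix.frobeniusNormedSpace


/-- Closed-form solution of the error equation in a general normed space. -/
lemma drem_aux {E : Type*} [NormedAddCommGroup E] [NormedSpace ℝ E]
    (α : ℝ) (Δ : ℝ → ℝ) (hΔ : Continuous Δ) (P : E) (Y : ℝ → E)
    (h : ∀ t ≥ (0 : ℝ), HasDerivAt Y ((α * Δ t) • (Δ t • P - Δ t • Y t)) t)
    (t : ℝ) (ht : 0 ≤ t) :
    Y t = P + Real.exp (-α * ∫ τ in (0 : ℝ)..t, (Δ τ) ^ 2) • (Y 0 - P) := by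
  have hI : ∀ s : ℝ, HasDerivAt (fun s => ∫ τ in (0 : ℝ)..s, (Δ τ) ^ 2) ((Δ s) ^ 2) s := by
    intro s
    have hc : Continuous fun τ => (Δ τ) ^ 2 := by fun_prop
    exact hc.integral_hasStrictDerivAt 0 s |>.hasDerivAt
  have hg : ∀ s ≥ (0 : ℝ), HasDerivAt
      (fun s => Real.exp (α * ∫ τ in (0 : ℝ)..s, (Δ τ) ^ 2) • (Y s - P)) 0 s := by
    intro s hs
    have h1 := (((hI s).const_mul α).exp).smul ((h s hs).sub_const P)
    refine h1.congr_deriv ?_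
    module
  have hconst := constant_of_has_deriv_right_zero (a := 0) (b := t)
    (fun s hs => (hg s hs.1).continuousAt.continuousWithinAt)
    (fun s hs => (hg s hs.1).hasDerivWithinAt) t ⟨ht, le_rfl⟩
  simp only [intervalIntegral.integral_same, mul_zero, Real.exp_zero, one_smul] at hconst
  rw [← hconst, smul_smul, ← Real.exp_add]
  simp

lemma drem_aux_tendsto {E : Type*} [NormedAddCommGroup E] [NormedSpace ℝ E]
    (α : ℝ) (hα : 0 < α) (Δ : ℝ → ℝ) (hΔ : Continuous Δ) (P : E) (Y : ℝ → E)
    (h : ∀ t ≥ (0 : ℝ), HasDerivAt Y ((α * Δ t) • (Δ t • P - Δ t • Y t)) t)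
    (hT : Filter.Tendsto (fun t => ∫ τ in (0 : ℝ)..t, (Δ τ) ^ 2) Filter.atTop Filter.atTop) :
    Filter.Tendsto Y Filter.atTop (nhds P) := by
  have h0 : Filter.Tendsto (fun t => Real.exp (-α * ∫ τ in (0 : ℝ)..t, (Δ τ) ^ 2))
      Filter.atTop (nhds 0) :=
    Real.tendsto_exp_atBot.comp (hT.const_mul_atTop_of_neg (neg_lt_zero.mpr hα))
  have h1 := (h0.smul_const (Y 0 - P)).const_add P
  rw [zero_smul, add_zero] at h1
  refine h1.congr' ?_
  filter_upwards [Filter.eventually_ge_atTop 0] with t ht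
  exact (drem_aux α Δ hΔ P Y h t ht).symm

lemma drem_aux_finite {E : Type*} [NormedAddCommGroup E] [NormedSpace ℝ E]
    (α : ℝ) (hα : 0 < α) (Δ : ℝ → ℝ) (hΔ : Continuous Δ) (P : E) (Y : ℝ → E)
    (h : ∀ t ≥ (0 : ℝ), HasDerivAt Y ((α * Δ t) • (Δ t • P - Δ t • Y t)) t)
    (c : ℝ) (hc : 0 < c) (σ : ℝ) (hσ : σ ∈ Set.Ioo (0 : ℝ) 1)
    (hIE : (∫ τ in (0 : ℝ)..c, (Δ τ) ^ 2) ≥ -(1 / α) * Real.log (1 - σ))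
    (t : ℝ) (ht : c ≤ t) :
    (1 / (1 - Real.exp (-α * ∫ τ in (0 : ℝ)..t, (Δ τ) ^ 2))) •
      (Y t - Real.exp (-α * ∫ τ in (0 : ℝ)..t, (Δ τ) ^ 2) • Y 0) = P := by
  have hcont : Continuous fun τ => (Δ τ) ^ 2 := by fun_prop
  have hlog : Real.log (1 - σ) < 0 :=
    Real.log_neg (by linarith [hσ.2]) (by linarith [hσ.1])
  have hpos : 0 < ∫ τ in (0 : ℝ)..c, (Δ τ) ^ 2 := by
    have : 0 < 1 / α := by positivity
    nlinarith
  have hmono : (∫ τ in (0 : ℝ)..c, (Δ τ) ^ 2) ≤ ∫ τ in (0 : ℝ)..t, (Δ τ) ^ 2 := by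
    rw [← intervalIntegral.integral_add_adjacent_intervals
      (hcont.intervalIntegrable 0 c) (hcont.intervalIntegrable c t)]
    have := intervalIntegral.integral_nonneg (μ := MeasureTheory.volume) ht
      (fun u _ => sq_nonneg (Δ u))
    linarith
  have hs : Real.exp (-α * ∫ τ in (0 : ℝ)..t, (Δ τ) ^ 2) < 1 := by
    rw [Real.exp_lt_one_iff]
    nlinarith
  rw [drem_aux α Δ hΔ P Y h t (hc.le.trans ht)]
  generalize Real.exp (-α * ∫ τ in (0 : ℝ)..t, (Δ τ) ^ 2) = s at hs
  have hne : 1 - s ≠ 0 := by linarith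
  have : P + s • (Y 0 - P) - s • Y 0 = (1 - s) • P := by module
  rw [this, smul_smul, one_div_mul_cancel hne, one_smul]

/-- DREM estimation of the full parameter matrix `Ψ* = [Aᵀ, Bᵀ, Cᵀ]ᵀ`:
(i) asymptotic convergence when `∫₀ᵗ Δ² → ∞`; (ii) finite-time exact recovery
under the modified interval-excitation condition. -/
theorem drem_full_matrix_estimation {n m q : ℕ}
    (α : ℝ) (hα : 0 < α)
    (Δ : ℝ → ℝ) (hΔ : Continuous Δ)
    (Ψstar : Matrix (Fin (n + m + q)) (Fin n) ℝ)
    (ℰ : ℝ → Matrix (Fin (n + m + q)) (Fin n) ℝ)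
    (hℰ : ∀ t, ℰ t = Δ t • Ψstar)
    (Ψ : ℝ → Matrix (Fin (n + m + q)) (Fin n) ℝ)
    (hupd : ∀ t ≥ (0 : ℝ), HasDerivAt Ψ ((α * Δ t) • (ℰ t - Δ t • Ψ t)) t) :
    (Filter.Tendsto (fun t => ∫ τ in (0 : ℝ)..t, (Δ τ) ^ 2)
        Filter.atTop Filter.atTop →
      Filter.Tendsto Ψ Filter.atTop (nhds Ψstar)) ∧
    (∀ t_c > (0 : ℝ), ∀ σ ∈ Set.Ioo (0 : ℝ) 1,
      (∫ τ in (0 : ℝ)..t_c, (Δ τ) ^ 2) ≥ -(1 / α) * Real.log (1 - σ) →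
      ∀ t ≥ t_c,
        (1 / (1 - Real.exp (-α * ∫ τ in (0 : ℝ)..t, (Δ τ) ^ 2))) •
            (Ψ t - Real.exp (-α * ∫ τ in (0 : ℝ)..t, (Δ τ) ^ 2) • Ψ 0)
          = Ψstar) := by
  simp only [hℰ] at hupd
  exact ⟨fun hT => drem_aux_tendsto α hα Δ hΔ Ψstar Ψ hupd hT,
    fun c hc σ hσ hIE t ht => drem_aux_finite α hα Δ hΔ Ψstar Ψ hupd c hc σ hσ hIE t ht⟩
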